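/- arXiv:1503.02180 — 4 statements merged into one kernel-verified Lean document; each statement's English description precedes it below -/
import Mathlib

section
/- Let n ≥ 1 and T > 0. For each k ∈ ℕ let F_k : ℝ × ℝ^n × ℝ × ℝ^n × M_n(ℝ) → ℝ be continuous and degenerate elliptic, i.e. F_k(t,x,r,p,X) ≤ F_k(t,x,r,p,Y) whenever X, Y are symmetric and Y − X is positive semidefinite. Let F : ℝ × ℝ^n × ℝ × ℝ^n × M_n(ℝ) → ℝ be continuous, and suppose F_k → F uniformly on every compact subset of ℝ × ℝ^n × ℝ × ℝ^n × M_n(ℝ). For each k let u_k : [0,T] × ℝ^n → ℝ be a continuous viscosity subsolution of ∂u/∂t + F_k(t, x, u, D_x u, D²_x u) = 0 on [0,T) × ℝ^n, let u : [0,T] × ℝ^n → ℝ be continuous, and suppose u_k → u uniformly on every compact subset of [0,T] × ℝ^n. Then u is a viscosity subsolution of the limit equation ∂u/∂t + F(t, x, u, D_x u, D²_x u) = 0 on [0,T) × ℝ^n. -/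
/-- A test function `φ : ℝ × ℝⁿ → ℝ` of class `C^{1,2}`, together with its time derivative `φt`,
spatial gradient `g` and spatial Hessian matrix `Hm`, all continuous. -/
def IsC12 (n : ℕ) (φ φt : ℝ × EuclideanSpace ℝ (Fin n) → ℝ)
    (g : ℝ × EuclideanSpace ℝ (Fin n) → EuclideanSpace ℝ (Fin n))
    (Hm : ℝ × EuclideanSpace ℝ (Fin n) → Matrix (Fin n) (Fin n) ℝ) : Prop :=
  Continuous φ ∧ Continuous φt ∧ Continuous g ∧ Continuous Hm ∧
    (∀ (t : ℝ) (x : EuclideanSpace ℝ (Fin n)),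
      HasDerivAt (fun s : ℝ => φ (s, x)) (φt (t, x)) t) ∧
    (∀ (t : ℝ) (x : EuclideanSpace ℝ (Fin n)),
      HasGradientAt (fun y => φ (t, y)) (g (t, x)) x) ∧
    (∀ (t : ℝ) (x : EuclideanSpace ℝ (Fin n)),
      HasFDerivAt (fun y => g (t, y))
        (LinearMap.toContinuousLinearMap (Matrix.toEuclideanLin (Hm (t, x)))) x)

/-- `u` is a continuous viscosity subsolution of `∂u/∂t + F(t, x, u, D_x u, D²_x u) = 0` on
`[0,T) × ℝⁿ`: whenever a `C^{1,2}` test function `φ` is such that `φ - u` attains a global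
minimum over `[0,T] × ℝⁿ` at `(t,x)` with `0 ≤ t < T`, one has
`∂φ/∂t(t,x) + F(t, x, φ(t,x), D_x φ(t,x), D²_x φ(t,x)) ≥ 0`. -/
def IsViscositySubsolution (n : ℕ) (T : ℝ)
    (F : ℝ → EuclideanSpace ℝ (Fin n) → ℝ → EuclideanSpace ℝ (Fin n) →
      Matrix (Fin n) (Fin n) ℝ → ℝ)
    (u : ℝ × EuclideanSpace ℝ (Fin n) → ℝ) : Prop :=
  ∀ φ φt g Hm, IsC12 n φ φt g Hm →
    ∀ (t : ℝ) (x : EuclideanSpace ℝ (Fin n)), 0 ≤ t → t < T →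
      (∀ (s : ℝ) (y : EuclideanSpace ℝ (Fin n)), 0 ≤ s → s ≤ T →
        φ (t, x) - u (t, x) ≤ φ (s, y) - u (s, y)) →
      0 ≤ φt (t, x) + F t x (φ (t, x)) (g (t, x)) (Hm (t, x))

open Set Metric Topology Filter

/-- A function of class `C^{1,2}` stays so after adding another one. -/
lemma IsC12.add {n : ℕ} {φ φt ψ ψt : ℝ × EuclideanSpace ℝ (Fin n) → ℝ}
    {g h : ℝ × EuclideanSpace ℝ (Fin n) → EuclideanSpace ℝ (Fin n)}
    {Hm Km : ℝ × EuclideanSpace ℝ (Fin n) → Matrix (Fin n) (Fin n) ℝ}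
    (hφ : IsC12 n φ φt g Hm) (hψ : IsC12 n ψ ψt h Km) :
    IsC12 n (φ + ψ) (φt + ψt) (g + h) (Hm + Km) := by
  obtain ⟨a1, a2, a3, a4, a5, a6, a7⟩ := hφ
  obtain ⟨b1, b2, b3, b4, b5, b6, b7⟩ := hψ
  refine ⟨a1.add b1, a2.add b2, a3.add b3, a4.add b4, fun t x => (a5 t x).add (b5 t x),
    fun t x => ?_, fun t x => ?_⟩
  · exact hasGradientAt_iff_hasFDerivAt.2
      (((a6 t x).hasFDerivAt.add (b6 t x).hasFDerivAt).congr_fderiv (by ext v; simp))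
  · exact ((a7 t x).add (b7 t x)).congr_fderiv (by ext1 v; simp)

/-- A scalar multiple of a function of class `C^{1,2}` is of class `C^{1,2}`. -/
lemma IsC12.const_smul {n : ℕ} {φ φt : ℝ × EuclideanSpace ℝ (Fin n) → ℝ}
    {g : ℝ × EuclideanSpace ℝ (Fin n) → EuclideanSpace ℝ (Fin n)}
    {Hm : ℝ × EuclideanSpace ℝ (Fin n) → Matrix (Fin n) (Fin n) ℝ}
    (hφ : IsC12 n φ φt g Hm) (c : ℝ) :
    IsC12 n (c • φ) (c • φt) (c • g) (c • Hm) := by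
  obtain ⟨a1, a2, a3, a4, a5, a6, a7⟩ := hφ
  refine ⟨a1.const_smul c, a2.const_smul c, a3.const_smul c, a4.const_smul c,
    fun t x => (a5 t x).const_smul c, fun t x => ?_, fun t x => ?_⟩
  · exact hasGradientAt_iff_hasFDerivAt.2
      (((a6 t x).hasFDerivAt.const_smul c).congr_fderiv (by ext v; simp))
  · exact ((a7 t x).const_smul c).congr_fderiv (by ext1 v; simp)

/-- The Hessian matrix of `f`, as the Jacobian matrix of its gradient. -/
noncomputable def hessianMatrix {n : ℕ} (f : EuclideanSpace ℝ (Fin n) → ℝ)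
    (x : EuclideanSpace ℝ (Fin n)) : Matrix (Fin n) (Fin n) ℝ :=
  Matrix.of fun i j => fderiv ℝ (gradient f) x (EuclideanSpace.single j 1) i

lemma ContDiff.gradient {n : ℕ} {f : EuclideanSpace ℝ (Fin n) → ℝ} (hf : ContDiff ℝ 2 f) :
    ContDiff ℝ 1 (gradient f) :=
  (InnerProductSpace.toDual ℝ (EuclideanSpace ℝ (Fin n))).symm.toContinuousLinearEquiv.contDiff.comp
    (hf.fderiv_right (m := 1) (by norm_num))

lemma toEuclideanLin_hessianMatrix {n : ℕ} (f : EuclideanSpace ℝ (Fin n) → ℝ)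
    (x : EuclideanSpace ℝ (Fin n)) :
    LinearMap.toContinuousLinearMap (Matrix.toEuclideanLin (hessianMatrix f x)) =
      fderiv ℝ (gradient f) x := by
  have : Matrix.toEuclideanLin (hessianMatrix f x) =
      (fderiv ℝ (gradient f) x : EuclideanSpace ℝ (Fin n) →ₗ[ℝ] EuclideanSpace ℝ (Fin n)) := by
    refine (EuclideanSpace.basisFun (Fin n) ℝ).toBasis.ext fun j => ?_
    ext i
    simp [hessianMatrix, Matrix.toLpLin_apply]
  ext1 v
  exact congrArg (fun L => L v) this

/-- A `C²` function of the space variable alone is of class `C^{1,2}`. -/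
lemma isC12_comp_snd {n : ℕ} {f : EuclideanSpace ℝ (Fin n) → ℝ} (hf : ContDiff ℝ 2 f) :
    IsC12 n (fun q => f q.2) 0 (fun q => gradient f q.2) (fun q => hessianMatrix f q.2) := by
  refine ⟨hf.continuous.comp continuous_snd, continuous_const,
    hf.gradient.continuous.comp continuous_snd, ?_, fun t x => hasDerivAt_const t (f x),
    fun t x => ((hf.differentiable (by norm_num)) x).hasGradientAt, fun t x => ?_⟩
  · refine continuous_matrix fun i j => ?_
    have h1 : Continuous (fderiv ℝ (gradient f)) := hf.gradient.continuous_fderiv (by norm_num)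
    have h2 : Continuous fun q : ℝ × EuclideanSpace ℝ (Fin n) =>
        fderiv ℝ (gradient f) q.2 (EuclideanSpace.single j 1) :=
      (h1.comp continuous_snd).clm_apply continuous_const
    exact (EuclideanSpace.proj i : EuclideanSpace ℝ (Fin n) →L[ℝ] ℝ).continuous.comp h2
  · rw [toEuclideanLin_hessianMatrix]
    exact ((hf.gradient.differentiable (by norm_num)) x).hasFDerivAt

/-- A `C¹` function of the time variable alone is of class `C^{1,2}`. -/
lemma isC12_comp_fst {n : ℕ} {f f' : ℝ → ℝ} (hf : ∀ s, HasDerivAt f (f' s) s)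
    (hf' : Continuous f') :
    IsC12 n (fun q => f q.1) (fun q => f' q.1) 0 0 := by
  have hc : Continuous f := continuous_iff_continuousAt.2 fun s => (hf s).continuousAt
  refine ⟨hc.comp continuous_fst, hf'.comp continuous_fst, continuous_const, continuous_const,
    fun t x => hf t, fun t x => hasGradientAt_const x (f t), fun t x => ?_⟩
  exact (hasFDerivAt_const (0 : EuclideanSpace ℝ (Fin n)) x).congr_fderiv (by ext1 v; simp)

lemma gradient_eq_zero_of_eventuallyEq {n : ℕ} {f : EuclideanSpace ℝ (Fin n) → ℝ}
    {x : EuclideanSpace ℝ (Fin n)} (h : f =ᶠ[𝓝 x] 0) : gradient f x = 0 := by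
  simp [gradient, h.fderiv_eq]

lemma hessianMatrix_eq_zero_of_eventuallyEq {n : ℕ} {f : EuclideanSpace ℝ (Fin n) → ℝ}
    {x : EuclideanSpace ℝ (Fin n)} (h : f =ᶠ[𝓝 x] 0) : hessianMatrix f x = 0 := by
  have h' : gradient f =ᶠ[𝓝 x] 0 :=
    h.eventuallyEq_nhds.mono fun _ hy => gradient_eq_zero_of_eventuallyEq hy
  ext i j
  simp [hessianMatrix, h'.fderiv_eq]

/-- A nonnegative `C²` function vanishing on the unit ball around `x` and dominating a given
continuous function on `[0,T] × ℝⁿ` away from the ball of radius `2`. -/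
lemma exists_contDiff_dominating {n : ℕ} {T : ℝ} {G : ℝ × EuclideanSpace ℝ (Fin n) → ℝ}
    (hG : ContinuousOn G (Icc 0 T ×ˢ univ)) (x : EuclideanSpace ℝ (Fin n)) :
    ∃ η : EuclideanSpace ℝ (Fin n) → ℝ, ContDiff ℝ 2 η ∧ (∀ y, 0 ≤ η y) ∧
      (∀ y, dist y x ≤ 1 → η y = 0) ∧
      ∀ y, 2 ≤ dist y x → ∀ s ∈ Icc 0 T, G (s, y) ≤ η y := by
  let S : EuclideanSpace ℝ (Fin n) → Set ℝ := fun y =>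
    {r | 0 ≤ r ∧ (dist y x ≤ 1 → r = 0) ∧ (2 ≤ dist y x → ∀ s ∈ Icc 0 T, G (s, y) ≤ r)}
  have hS : ∀ y, Convex ℝ (S y) := by
    intro y a ha b hb α β hα hβ hαβ
    refine ⟨?_, fun h => ?_, fun h s hs => ?_⟩
    · exact add_nonneg (mul_nonneg hα ha.1) (mul_nonneg hβ hb.1)
    · simp [ha.2.1 h, hb.2.1 h]
    · have h1 := mul_le_mul_of_nonneg_left (ha.2.2 h s hs) hα
      have h2 := mul_le_mul_of_nonneg_left (hb.2.2 h s hs) hβ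
      have h3 : G (s, y) = α * G (s, y) + β * G (s, y) := by rw [← add_mul, hαβ, one_mul]
      simp only [smul_eq_mul]
      linarith
  have hloc : ∀ y, ∃ c : ℝ, ∀ᶠ z in 𝓝 y, c ∈ S z := by
    intro y
    rcases lt_or_ge (dist y x) 2 with h | h
    · refine ⟨0, ?_⟩
      filter_upwards [(continuous_id.dist continuous_const).continuousAt.eventually_lt
        continuousAt_const h] with z hz
      exact ⟨le_rfl, fun _ => rfl, fun h' => absurd hz (not_lt.2 h')⟩
    · obtain ⟨c, hc⟩ := ((isCompact_Icc (a := (0 : ℝ)) (b := T)).prod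
        (isCompact_closedBall y 1)).bddAbove_image
        (hG.mono (prod_mono subset_rfl (subset_univ _)))
      refine ⟨max c 0, ?_⟩
      filter_upwards [closedBall_mem_nhds y one_pos, continuousAt_const.eventually_lt
        (continuous_id.dist continuous_const).continuousAt (lt_of_lt_of_le one_lt_two h)]
        with z hz hz'
      exact ⟨le_max_right _ _, fun h' => absurd hz' (not_lt.2 h'), fun _ s hs =>
        (hc (mem_image_of_mem G (mk_mem_prod hs hz))).trans (le_max_left _ _)⟩
  obtain ⟨η, hη⟩ := exists_contMDiffMap_forall_mem_convex_of_local_const (n := 2)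
    (modelWithCornersSelf ℝ (EuclideanSpace ℝ (Fin n))) hS hloc
  exact ⟨η, η.contMDiff.contDiff, fun y => (hη y).1,
    fun y => (hη y).2.1, fun y => (hη y).2.2⟩

/-- The subsolution inequality for the limit at a strict minimum point. -/
lemma subsolution_ineq_of_strict_min {n : ℕ} {T : ℝ}
    {Fk : ℕ → ℝ → EuclideanSpace ℝ (Fin n) → ℝ → EuclideanSpace ℝ (Fin n) →
      Matrix (Fin n) (Fin n) ℝ → ℝ}
    {F : ℝ → EuclideanSpace ℝ (Fin n) → ℝ → EuclideanSpace ℝ (Fin n) →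
      Matrix (Fin n) (Fin n) ℝ → ℝ}
    (hFcont : Continuous fun q : ℝ × EuclideanSpace ℝ (Fin n) × ℝ ×
      EuclideanSpace ℝ (Fin n) × Matrix (Fin n) (Fin n) ℝ =>
      F q.1 q.2.1 q.2.2.1 q.2.2.2.1 q.2.2.2.2)
    (hFconv : ∀ K : Set (ℝ × EuclideanSpace ℝ (Fin n) × ℝ × EuclideanSpace ℝ (Fin n) ×
      Matrix (Fin n) (Fin n) ℝ), IsCompact K → ∀ ε : ℝ, 0 < ε → ∃ N : ℕ, ∀ k : ℕ, N ≤ k →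
      ∀ q ∈ K, |Fk k q.1 q.2.1 q.2.2.1 q.2.2.2.1 q.2.2.2.2 -
        F q.1 q.2.1 q.2.2.1 q.2.2.2.1 q.2.2.2.2| ≤ ε)
    {uk : ℕ → ℝ × EuclideanSpace ℝ (Fin n) → ℝ}
    {u : ℝ × EuclideanSpace ℝ (Fin n) → ℝ}
    (hukcont : ∀ k : ℕ, ContinuousOn (uk k) (Icc 0 T ×ˢ univ))
    (huksub : ∀ k : ℕ, IsViscositySubsolution n T (Fk k) (uk k))
    (hucont : ContinuousOn u (Icc 0 T ×ˢ univ))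
    (huconv : ∀ K : Set (ℝ × EuclideanSpace ℝ (Fin n)),
      K ⊆ Icc 0 T ×ˢ univ → IsCompact K → ∀ ε : ℝ, 0 < ε → ∃ N : ℕ, ∀ k : ℕ, N ≤ k →
      ∀ q ∈ K, |uk k q - u q| ≤ ε)
    {φ φt : ℝ × EuclideanSpace ℝ (Fin n) → ℝ}
    {g : ℝ × EuclideanSpace ℝ (Fin n) → EuclideanSpace ℝ (Fin n)}
    {Hm : ℝ × EuclideanSpace ℝ (Fin n) → Matrix (Fin n) (Fin n) ℝ}
    (hφ : IsC12 n φ φt g Hm) {t : ℝ} {x : EuclideanSpace ℝ (Fin n)} (ht0 : 0 ≤ t) (htT : t < T)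
    (hmin : ∀ q : ℝ × EuclideanSpace ℝ (Fin n), q.1 ∈ Icc 0 T → q ≠ (t, x) →
      φ (t, x) - u (t, x) < φ q - u q) :
    0 ≤ φt (t, x) + F t x (φ (t, x)) (g (t, x)) (Hm (t, x)) := by
  by_contra! hneg
  obtain ⟨cφ, cφt, cg, cH, -⟩ := id hφ
  let jet : ℝ × EuclideanSpace ℝ (Fin n) → ℝ × EuclideanSpace ℝ (Fin n) × ℝ ×
      EuclideanSpace ℝ (Fin n) × Matrix (Fin n) (Fin n) ℝ :=
    fun q => (q.1, q.2, φ q, g q, Hm q)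
  have hjet : Continuous jet := by fun_prop
  have hΦ : Continuous fun q : ℝ × EuclideanSpace ℝ (Fin n) =>
      φt q + F q.1 q.2 (φ q) (g q) (Hm q) := cφt.add (hFcont.comp hjet)
  obtain ⟨c, hc, hc'⟩ : ∃ c > 0, φt (t, x) + F t x (φ (t, x)) (g (t, x)) (Hm (t, x)) < -c :=
    ⟨-(φt (t, x) + F t x (φ (t, x)) (g (t, x)) (Hm (t, x))) / 2, by linarith, by linarith⟩
  obtain ⟨ρ, hρ, hρball⟩ := Metric.mem_nhds_iff.1
    (hΦ.continuousAt.eventually_lt (x₀ := (t, x)) continuousAt_const hc')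
  obtain ⟨r, hr, hrlt⟩ := exists_between (lt_min hρ (lt_min one_pos (sub_pos.2 htT)))
  obtain ⟨hrρ, hr1, hrT⟩ := by simpa only [lt_min_iff] using hrlt
  obtain ⟨N₁, hN₁⟩ := hFconv _ ((isCompact_closedBall (t, x) r).image hjet) c hc
  let C : Set (ℝ × EuclideanSpace ℝ (Fin n)) := Icc 0 T ×ˢ closedBall x 2
  have hC : IsCompact C := isCompact_Icc.prod (isCompact_closedBall x 2)
  have hCsub : C ⊆ Icc 0 T ×ˢ univ := prod_mono subset_rfl (subset_univ _)
  have htx : (t, x) ∈ C := ⟨⟨ht0, htT.le⟩, mem_closedBall_self (by norm_num)⟩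
  -- the gap of the strict minimum outside the small ball
  obtain ⟨ε, hε, hgap⟩ : ∃ ε > 0, ∀ q ∈ C \ ball (t, x) r,
      φ (t, x) - u (t, x) + 2 * ε ≤ φ q - u q := by
    rcases (C \ ball (t, x) r).eq_empty_or_nonempty with he | hne
    · exact ⟨1, one_pos, by simp [he]⟩
    · obtain ⟨q, hq, hqmin⟩ := (hC.diff isOpen_ball).exists_isMinOn hne
        ((cφ.continuousOn.sub hucont).mono (sdiff_subset.trans hCsub))
      have hlt := hmin q hq.1.1 fun h => hq.2 (h ▸ mem_ball_self hr)
      refine ⟨((φ q - u q) - (φ (t, x) - u (t, x))) / 2, by linarith, fun p hp => ?_⟩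
      have : φ q - u q ≤ φ p - u p := hqmin hp
      linarith
  obtain ⟨N₂, hN₂⟩ := huconv C hCsub hC ε hε
  obtain ⟨k, hk₁, hk₂⟩ : ∃ k, N₁ ≤ k ∧ N₂ ≤ k := ⟨max N₁ N₂, le_max_left _ _, le_max_right _ _⟩
  obtain ⟨η, hη, hη0, hη1, hη2⟩ := exists_contDiff_dominating
    (G := fun q => uk k q - φ q + (φ (t, x) - uk k (t, x)))
    (((hukcont k).sub cφ.continuousOn).add continuousOn_const) x
  have hψ := hφ.add (isC12_comp_snd hη)
  obtain ⟨⟨s, y⟩, hq, hqmin⟩ := (hC.inter_right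
    (isClosed_closedBall (x := (t, x)) (ε := r))).exists_isMinOn
    ⟨(t, x), htx, mem_closedBall_self hr.le⟩
    ((hψ.1.continuousOn.sub (hukcont k)).mono (inter_subset_left.trans hCsub))
  have hdist : dist s t ≤ r ∧ dist y x ≤ r := by
    simpa [Prod.dist_eq] using hq.2
  have hsT : s < T := by
    have := (abs_le.1 (Real.dist_eq s t ▸ hdist.1)).2
    linarith
  have hle : φ (s, y) + η y - uk k (s, y) ≤ φ (t, x) - uk k (t, x) := by
    have : φ (s, y) + η y - uk k (s, y) ≤ φ (t, x) + η x - uk k (t, x) :=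
      hqmin (⟨htx, mem_closedBall_self hr.le⟩ : (t, x) ∈ C ∩ closedBall (t, x) r)
    rwa [hη1 x (by simp), add_zero] at this
  have hglob : ∀ (s' : ℝ) (y' : EuclideanSpace ℝ (Fin n)), 0 ≤ s' → s' ≤ T →
      φ (s, y) + η y - uk k (s, y) ≤ φ (s', y') + η y' - uk k (s', y') := by
    intro s' y' h0 hT'
    rcases le_total 2 (dist y' x) with hfar | hnear
    · have := hη2 y' hfar s' ⟨h0, hT'⟩
      linarith
    · have hCq : (s', y') ∈ C := ⟨⟨h0, hT'⟩, hnear⟩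
      by_cases hb : (s', y') ∈ closedBall (t, x) r
      · exact hqmin (⟨hCq, hb⟩ : (s', y') ∈ C ∩ closedBall (t, x) r)
      · have h1 := hgap (s', y') ⟨hCq, fun h => hb (ball_subset_closedBall h)⟩
        have h2 := abs_le.1 (hN₂ k hk₂ _ hCq)
        have h3 := abs_le.1 (hN₂ k hk₂ _ htx)
        have h4 := hη0 y'
        linarith
  have hzero : η =ᶠ[𝓝 y] 0 := by
    filter_upwards [isOpen_ball.mem_nhds (show y ∈ ball x 1 from hdist.2.trans_lt hr1)] with z hz
    exact hη1 z (le_of_lt hz)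
  have hsub := huksub k _ _ _ _ hψ s y hq.1.1.1 hsT hglob
  simp only [Pi.add_apply, Pi.zero_apply, add_zero, gradient_eq_zero_of_eventuallyEq hzero,
    hessianMatrix_eq_zero_of_eventuallyEq hzero, hzero.self_of_nhds] at hsub
  have hF : |Fk k s y (φ (s, y)) (g (s, y)) (Hm (s, y)) -
      F s y (φ (s, y)) (g (s, y)) (Hm (s, y))| ≤ c := hN₁ k hk₁ _ (mem_image_of_mem jet hq.2)
  have hlt : φt (s, y) + F s y (φ (s, y)) (g (s, y)) (Hm (s, y)) < -c :=
    hρball (closedBall_subset_ball hrρ hq.2)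
  linarith [(abs_le.1 hF).2]

/-- stability of viscosity subsolutions: if the continuous degenerate elliptic
operators `F_k` converge to `F` uniformly on compact sets, and the continuous viscosity
subsolutions `u_k` of the `F_k`-equations converge to `u` uniformly on compact subsets of
`[0,T] × ℝⁿ`, then `u` is a viscosity subsolution of the limit equation. -/
theorem stmt_8 (n : ℕ) (hn : 1 ≤ n) (T : ℝ) (hT : 0 < T)
    (Fk : ℕ → ℝ → EuclideanSpace ℝ (Fin n) → ℝ → EuclideanSpace ℝ (Fin n) →
      Matrix (Fin n) (Fin n) ℝ → ℝ)
    (F : ℝ → EuclideanSpace ℝ (Fin n) → ℝ → EuclideanSpace ℝ (Fin n) →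
      Matrix (Fin n) (Fin n) ℝ → ℝ)
    (hFkcont : ∀ k : ℕ, Continuous fun q : ℝ × EuclideanSpace ℝ (Fin n) × ℝ ×
      EuclideanSpace ℝ (Fin n) × Matrix (Fin n) (Fin n) ℝ =>
      Fk k q.1 q.2.1 q.2.2.1 q.2.2.2.1 q.2.2.2.2)
    (hFkell : ∀ (k : ℕ) (t : ℝ) (x : EuclideanSpace ℝ (Fin n)) (r : ℝ)
      (p : EuclideanSpace ℝ (Fin n)) (X Y : Matrix (Fin n) (Fin n) ℝ),
      X.IsSymm → Y.IsSymm → (Y - X).PosSemidef → Fk k t x r p X ≤ Fk k t x r p Y)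
    (hFcont : Continuous fun q : ℝ × EuclideanSpace ℝ (Fin n) × ℝ ×
      EuclideanSpace ℝ (Fin n) × Matrix (Fin n) (Fin n) ℝ =>
      F q.1 q.2.1 q.2.2.1 q.2.2.2.1 q.2.2.2.2)
    (hFconv : ∀ K : Set (ℝ × EuclideanSpace ℝ (Fin n) × ℝ × EuclideanSpace ℝ (Fin n) ×
      Matrix (Fin n) (Fin n) ℝ), IsCompact K → ∀ ε : ℝ, 0 < ε → ∃ N : ℕ, ∀ k : ℕ, N ≤ k →
      ∀ q ∈ K, |Fk k q.1 q.2.1 q.2.2.1 q.2.2.2.1 q.2.2.2.2 -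
        F q.1 q.2.1 q.2.2.1 q.2.2.2.1 q.2.2.2.2| ≤ ε)
    (uk : ℕ → ℝ × EuclideanSpace ℝ (Fin n) → ℝ)
    (u : ℝ × EuclideanSpace ℝ (Fin n) → ℝ)
    (hukcont : ∀ k : ℕ, ContinuousOn (uk k) (Set.Icc 0 T ×ˢ Set.univ))
    (huksub : ∀ k : ℕ, IsViscositySubsolution n T (Fk k) (uk k))
    (hucont : ContinuousOn u (Set.Icc 0 T ×ˢ Set.univ))
    (huconv : ∀ K : Set (ℝ × EuclideanSpace ℝ (Fin n)),
      K ⊆ Set.Icc 0 T ×ˢ Set.univ → IsCompact K → ∀ ε : ℝ, 0 < ε → ∃ N : ℕ, ∀ k : ℕ, N ≤ k →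
      ∀ q ∈ K, |uk k q - u q| ≤ ε) :
    IsViscositySubsolution n T F u := by
  intro φ φt g Hm hφ t x ht0 htT hmin
  have hq2 : ContDiff ℝ 2 fun y : EuclideanSpace ℝ (Fin n) => ‖y - x‖ ^ 2 :=
    (contDiff_id.sub contDiff_const).norm_sq ℝ
  have hq1 : ∀ s : ℝ, HasDerivAt (fun s => (s - t) ^ 2) (2 * (s - t)) s := fun s => by
    simpa using ((hasDerivAt_id s).sub_const t).fun_pow 2
  have hpert := (isC12_comp_fst (n := n) hq1 (by fun_prop)).add (isC12_comp_snd hq2)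
  have hstep : ∀ δ : ℝ, 0 < δ → 0 ≤ φt (t, x) + F t x (φ (t, x))
      (g (t, x) + δ • gradient (fun y => ‖y - x‖ ^ 2) x)
      (Hm (t, x) + δ • hessianMatrix (fun y => ‖y - x‖ ^ 2) x) := by
    intro δ hδ
    have := subsolution_ineq_of_strict_min hFcont hFconv hukcont huksub hucont huconv
      (hφ.add (hpert.const_smul δ)) (x := x) ht0 htT ?_
    · simpa using this
    · rintro ⟨s, y⟩ hs hne
      have hpos : 0 < (s - t) ^ 2 + ‖y - x‖ ^ 2 := by
        by_contra! h
        have h1 : (s - t) ^ 2 = 0 := by nlinarith [sq_nonneg (s - t), sq_nonneg ‖y - x‖]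
        have h2 : ‖y - x‖ ^ 2 = 0 := by nlinarith [sq_nonneg (s - t), sq_nonneg ‖y - x‖]
        rw [sq_eq_zero_iff, sub_eq_zero] at h1
        rw [sq_eq_zero_iff, norm_eq_zero, sub_eq_zero] at h2
        exact hne (by rw [h1, h2])
      have h1 := hmin s y hs.1 hs.2
      have h2 := mul_pos hδ hpos
      simp only [Pi.add_apply, Pi.smul_apply, smul_eq_mul, sub_self, norm_zero]
      linarith
  have hcont : Continuous fun δ : ℝ => φt (t, x) + F t x (φ (t, x))
      (g (t, x) + δ • gradient (fun y => ‖y - x‖ ^ 2) x)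
      (Hm (t, x) + δ • hessianMatrix (fun y => ‖y - x‖ ^ 2) x) :=
    continuous_const.add (hFcont.comp (f := fun δ : ℝ => (t, x, φ (t, x),
      g (t, x) + δ • gradient (fun y => ‖y - x‖ ^ 2) x,
      Hm (t, x) + δ • hessianMatrix (fun y => ‖y - x‖ ^ 2) x)) (by fun_prop))
  have hlim := (hcont.tendsto 0).mono_left (nhdsWithin_le_nhds (s := Ioi 0))
  simp only [zero_smul, add_zero] at hlim
  exact ge_of_tendsto hlim (eventually_nhdsWithin_of_forall hstep)
end

section
/- Let n ≥ 1 and T > 0. For each k ∈ ℕ let F_k : ℝ × ℝ^n × ℝ × ℝ^n × M_n(ℝ) → ℝ be continuous and degenerate elliptic, i.e. F_k(t,x,r,p,X) ≤ F_k(t,x,r,p,Y) whenever X, Y are symmetric and Y − X is positive semidefinite. Let F : ℝ × ℝ^n × ℝ × ℝ^n × M_n(ℝ) → ℝ be continuous, and suppose F_k → F uniformly on every compact subset of ℝ × ℝ^n × ℝ × ℝ^n × M_n(ℝ). For each k let u_k : [0,T] × ℝ^n → ℝ be a continuous viscosity supersolution of ∂u/∂t + F_k(t, x, u, D_x u, D²_x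 u) = 0 on [0,T) × ℝ^n, let u : [0,T] × ℝ^n → ℝ be continuous, and suppose u_k → u uniformly on every compact subset of [0,T] × ℝ^n. Then u is a viscosity supersolution of the limit equation ∂u/∂t + F(t, x, u, D_x u, D²_x u) = 0 on [0,T) × ℝ^n. -/
/-- `u` is a continuous viscosity supersolution of `∂u/∂t + F(t, x, u, D_x u, D²_x u) = 0` on
`[0,T) × ℝⁿ`: whenever a `C^{1,2}` test function `φ` is such that `φ - u` attains a global
maximum over `[0,T] × ℝⁿ` at `(t,x)` with `0 ≤ t < T`, one has
`∂φ/∂t(t,x) + F(t, x, φ(t,x), D_x φ(t,x), D²_x φ(t,x)) ≤ 0`. -/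
def IsViscositySupersolution (n : ℕ) (T : ℝ)
    (F : ℝ → EuclideanSpace ℝ (Fin n) → ℝ → EuclideanSpace ℝ (Fin n) →
      Matrix (Fin n) (Fin n) ℝ → ℝ)
    (u : ℝ × EuclideanSpace ℝ (Fin n) → ℝ) : Prop :=
  ∀ φ φt g Hm, IsC12 n φ φt g Hm →
    ∀ (t : ℝ) (x : EuclideanSpace ℝ (Fin n)), 0 ≤ t → t < T →
      (∀ (s : ℝ) (y : EuclideanSpace ℝ (Fin n)), 0 ≤ s → s ≤ T →
        φ (s, y) - u (s, y) ≤ φ (t, x) - u (t, x)) →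
      φt (t, x) + F t x (φ (t, x)) (g (t, x)) (Hm (t, x)) ≤ 0

open Set Filter Topology
open scoped Manifold ContDiff

/-- A continuous function on `[0,T] × ℝⁿ` is dominated, away from a ball around `x`, by a `C²`
nonnegative radial function vanishing near `x`. -/
lemma exists_contDiff_radial_majorant {n : ℕ} {T : ℝ} (x : EuclideanSpace ℝ (Fin n))
    {f : ℝ × EuclideanSpace ℝ (Fin n) → ℝ} (hf : ContinuousOn f (Icc 0 T ×ˢ univ)) :
    ∃ h : ℝ → ℝ, ContDiff ℝ 2 h ∧ (∀ r ≤ 1, h r = 0) ∧ (∀ r, 0 ≤ h r) ∧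
      ∀ s ∈ Icc 0 T, ∀ y, 2 ≤ ‖y - x‖ ^ 2 → f (s, y) ≤ h (‖y - x‖ ^ 2) := by
  let A : ℝ → Set ℝ := fun r => {v | 0 ≤ v ∧ (r ≤ 1 → v = 0) ∧
    (2 ≤ r → ∀ s ∈ Icc 0 T, ∀ y, ‖y - x‖ ^ 2 = r → f (s, y) ≤ v)}
  have hconv : ∀ r, Convex ℝ (A r) := by
    rintro r v ⟨hv0, hv1, hv2⟩ w ⟨hw0, hw1, hw2⟩ a b ha hb hab
    refine ⟨by positivity, fun hr => by simp [hv1 hr, hw1 hr], fun hr s hs y hy => ?_⟩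
    have h1 := mul_le_mul_of_nonneg_left (hv2 hr s hs y hy) ha
    have h2 := mul_le_mul_of_nonneg_left (hw2 hr s hs y hy) hb
    calc f (s, y) = a * f (s, y) + b * f (s, y) := by rw [← add_mul, hab, one_mul]
      _ ≤ a • v + b • w := add_le_add h1 h2
  have hloc : ∀ r : ℝ, ∃ c : ℝ, ∀ᶠ r' in 𝓝 r, c ∈ A r' := by
    intro r
    rcases lt_or_ge r 2 with hr | hr
    · refine ⟨0, ?_⟩
      filter_upwards [Iio_mem_nhds hr] with r' hr'
      exact ⟨le_rfl, fun _ => rfl, fun h => absurd h (not_le.2 hr')⟩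
    · have hK : IsCompact (Icc (0 : ℝ) T ×ˢ Metric.closedBall x (r + 1)) :=
        isCompact_Icc.prod (isCompact_closedBall x (r + 1))
      obtain ⟨C, hC⟩ := (hK.image_of_continuousOn
        (hf.mono (prod_mono_right (subset_univ _)))).bddAbove
      refine ⟨max C 0, ?_⟩
      filter_upwards [Ioo_mem_nhds (show (1 : ℝ) < r by linarith) (lt_add_one r)] with r' hr'
      refine ⟨le_max_right _ _, fun h => absurd h (not_le.2 hr'.1), fun _ s hs y hy => ?_⟩
      refine le_max_of_le_left (hC ⟨(s, y), ⟨hs, ?_⟩, rfl⟩)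
      rw [mem_closedBall_iff_norm]
      have h0 := norm_nonneg (y - x)
      nlinarith [hr'.2]
  obtain ⟨h, hh⟩ := exists_contMDiffMap_forall_mem_convex_of_local_const (n := 2) 𝓘(ℝ, ℝ)
    hconv hloc
  exact ⟨h, h.contMDiff.contDiff, fun r hr => (hh r).2.1 hr, fun r => (hh r).1,
    fun s hs y hy => (hh _).2.2 hy s hs y rfl⟩

/-- Subtracting `(s - t)² + θ(‖y - x‖²)` from a `C^{1,2}` function, with `θ` of class `C²`. -/
lemma IsC12.sub_radial {n : ℕ} {φ φt : ℝ × EuclideanSpace ℝ (Fin n) → ℝ}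
    {g : ℝ × EuclideanSpace ℝ (Fin n) → EuclideanSpace ℝ (Fin n)}
    {Hm : ℝ × EuclideanSpace ℝ (Fin n) → Matrix (Fin n) (Fin n) ℝ}
    (hφ : IsC12 n φ φt g Hm) (t : ℝ) (x : EuclideanSpace ℝ (Fin n)) {θ θ₁ θ₂ : ℝ → ℝ}
    (hθ : ∀ r, HasDerivAt θ (θ₁ r) r) (hθ₁ : ∀ r, HasDerivAt θ₁ (θ₂ r) r)
    (hθ₂ : Continuous θ₂) :
    IsC12 n (fun q => φ q - ((q.1 - t) ^ 2 + θ (‖q.2 - x‖ ^ 2)))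
      (fun q => φt q - 2 * (q.1 - t))
      (fun q => g q - (2 * θ₁ (‖q.2 - x‖ ^ 2)) • (q.2 - x))
      (fun q => Hm q - ((2 * θ₁ (‖q.2 - x‖ ^ 2)) • (1 : Matrix (Fin n) (Fin n) ℝ) +
        (4 * θ₂ (‖q.2 - x‖ ^ 2)) • Matrix.vecMulVec (q.2 - x) (q.2 - x))) := by
  obtain ⟨c0, c1, c2, c3, d1, d2, d3⟩ := hφ
  have hc0 : Continuous θ := continuous_iff_continuousAt.2 fun r => (hθ r).continuousAt
  have hc1 : Continuous θ₁ := continuous_iff_continuousAt.2 fun r => (hθ₁ r).continuousAt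
  have hsq : ∀ y : EuclideanSpace ℝ (Fin n), HasFDerivAt (fun y => ‖y - x‖ ^ 2)
      (2 • (innerSL ℝ (y - x))) y := fun y => by
    simpa using! ((hasFDerivAt_id y).sub_const x).norm_sq
  refine ⟨by fun_prop, by fun_prop, by fun_prop, by fun_prop, fun s y => ?_, fun s y => ?_,
    fun s y => ?_⟩
  · have h1 := (((hasDerivAt_id s).sub_const t).pow 2).add_const (θ (‖y - x‖ ^ 2))
    simpa using! (d1 s y).sub h1
  · rw [hasGradientAt_iff_hasFDerivAt]
    have h1 := ((hθ _).comp_hasFDerivAt y (hsq y)).const_add ((s - t) ^ 2)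
    refine ((hasGradientAt_iff_hasFDerivAt.1 (d2 s y)).sub h1).congr_fderiv ?_
    ext v
    simp
    ring
  · have h1 := (((hθ₁ _).comp_hasFDerivAt y (hsq y)).const_mul 2).smul
      ((hasFDerivAt_id y).sub_const x)
    refine ((d3 s y).sub h1).congr_fderiv ?_
    ext v i
    simp [Matrix.toLpLin_apply, Matrix.vecMulVec_mulVec]
    have hinner : ∀ z : EuclideanSpace ℝ (Fin n), inner ℝ z v = z.ofLp ⬝ᵥ v.ofLp := fun z => by
      rw [EuclideanSpace.inner_eq_star_dotProduct, star_trivial, dotProduct_comm]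
    rw [hinner, hinner]
    ring

lemma deriv_eq_zero_of_eq_zero_on_Iic {h : ℝ → ℝ} {a : ℝ} (hz : ∀ r ≤ a, h r = 0) {r : ℝ}
    (hr : r < a) : deriv h r = 0 := by
  have : h =ᶠ[𝓝 r] fun _ => 0 := by
    filter_upwards [Iio_mem_nhds hr] with r' hr' using hz r' (le_of_lt hr')
  simpa using this.deriv_eq

/-- stability of viscosity supersolutions: if the continuous degenerate elliptic
operators `F_k` converge to `F` uniformly on compact sets, and the continuous viscosity
supersolutions `u_k` of the `F_k`-equations converge to `u` uniformly on compact subsets of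
`[0,T] × ℝⁿ`, then `u` is a viscosity supersolution of the limit equation. -/
theorem stmt_9 (n : ℕ) (hn : 1 ≤ n) (T : ℝ) (hT : 0 < T)
    (Fk : ℕ → ℝ → EuclideanSpace ℝ (Fin n) → ℝ → EuclideanSpace ℝ (Fin n) →
      Matrix (Fin n) (Fin n) ℝ → ℝ)
    (F : ℝ → EuclideanSpace ℝ (Fin n) → ℝ → EuclideanSpace ℝ (Fin n) →
      Matrix (Fin n) (Fin n) ℝ → ℝ)
    (hFkcont : ∀ k : ℕ, Continuous fun q : ℝ × EuclideanSpace ℝ (Fin n) × ℝ ×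
      EuclideanSpace ℝ (Fin n) × Matrix (Fin n) (Fin n) ℝ =>
      Fk k q.1 q.2.1 q.2.2.1 q.2.2.2.1 q.2.2.2.2)
    (hFkell : ∀ (k : ℕ) (t : ℝ) (x : EuclideanSpace ℝ (Fin n)) (r : ℝ)
      (p : EuclideanSpace ℝ (Fin n)) (X Y : Matrix (Fin n) (Fin n) ℝ),
      X.IsSymm → Y.IsSymm → (Y - X).PosSemidef → Fk k t x r p X ≤ Fk k t x r p Y)
    (hFcont : Continuous fun q : ℝ × EuclideanSpace ℝ (Fin n) × ℝ ×
      EuclideanSpace ℝ (Fin n) × Matrix (Fin n) (Fin n) ℝ =>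
      F q.1 q.2.1 q.2.2.1 q.2.2.2.1 q.2.2.2.2)
    (hFconv : ∀ K : Set (ℝ × EuclideanSpace ℝ (Fin n) × ℝ × EuclideanSpace ℝ (Fin n) ×
      Matrix (Fin n) (Fin n) ℝ), IsCompact K → ∀ ε : ℝ, 0 < ε → ∃ N : ℕ, ∀ k : ℕ, N ≤ k →
      ∀ q ∈ K, |Fk k q.1 q.2.1 q.2.2.1 q.2.2.2.1 q.2.2.2.2 -
        F q.1 q.2.1 q.2.2.1 q.2.2.2.1 q.2.2.2.2| ≤ ε)
    (uk : ℕ → ℝ × EuclideanSpace ℝ (Fin n) → ℝ)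
    (u : ℝ × EuclideanSpace ℝ (Fin n) → ℝ)
    (hukcont : ∀ k : ℕ, ContinuousOn (uk k) (Set.Icc 0 T ×ˢ Set.univ))
    (huksuper : ∀ k : ℕ, IsViscositySupersolution n T (Fk k) (uk k))
    (hucont : ContinuousOn u (Set.Icc 0 T ×ˢ Set.univ))
    (huconv : ∀ K : Set (ℝ × EuclideanSpace ℝ (Fin n)),
      K ⊆ Set.Icc 0 T ×ˢ Set.univ → IsCompact K → ∀ ε : ℝ, 0 < ε → ∃ N : ℕ, ∀ k : ℕ, N ≤ k →
      ∀ q ∈ K, |uk k q - u q| ≤ ε) :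
    IsViscositySupersolution n T F u := by
  intro φ φt g Hm hφ t x ht0 htT hmax
  by_contra! hpos
  set L := φt (t, x) + F t x (φ (t, x)) (g (t, x)) (Hm (t, x)) with hL
  -- the test function penalized by `(s - t)² + ‖y - x‖⁴`, and its derivatives
  set ψ : ℝ × EuclideanSpace ℝ (Fin n) → ℝ :=
    fun q => φ q - ((q.1 - t) ^ 2 + (‖q.2 - x‖ ^ 2) ^ 2) with hψ
  set ψt : ℝ × EuclideanSpace ℝ (Fin n) → ℝ := fun q => φt q - 2 * (q.1 - t) with hψt
  set ψg : ℝ × EuclideanSpace ℝ (Fin n) → EuclideanSpace ℝ (Fin n) :=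
    fun q => g q - (2 * (2 * ‖q.2 - x‖ ^ 2)) • (q.2 - x) with hψg
  set ψH : ℝ × EuclideanSpace ℝ (Fin n) → Matrix (Fin n) (Fin n) ℝ :=
    fun q => Hm q - ((2 * (2 * ‖q.2 - x‖ ^ 2)) • (1 : Matrix (Fin n) (Fin n) ℝ) +
        (4 * 2 : ℝ) • Matrix.vecMulVec (q.2 - x) (q.2 - x)) with hψH
  have hd0 : ∀ r : ℝ, HasDerivAt (fun r : ℝ => r ^ 2) (2 * r) r := fun r => by
    simpa using hasDerivAt_pow 2 r
  have hd1 : ∀ r : ℝ, HasDerivAt (fun r : ℝ => 2 * r) 2 r := fun r => by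
    simpa using (hasDerivAt_id r).const_mul 2
  obtain ⟨hψc, hψtc, hψgc, hψHc, -⟩ : IsC12 n ψ ψt ψg ψH :=
    hφ.sub_radial t x hd0 hd1 continuous_const
  let J : ℝ × EuclideanSpace ℝ (Fin n) → ℝ × EuclideanSpace ℝ (Fin n) × ℝ ×
      EuclideanSpace ℝ (Fin n) × Matrix (Fin n) (Fin n) ℝ :=
    fun q => (q.1, q.2, ψ q, ψg q, ψH q)
  have hJ : Continuous J := by fun_prop
  have hG : Continuous fun q => ψt q + F q.1 q.2 (ψ q) (ψg q) (ψH q) :=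
    hψtc.add (hFcont.comp hJ)
  have hGL : ψt (t, x) + F t x (ψ (t, x)) (ψg (t, x)) (ψH (t, x)) = L := by
    simp [hψ, hψt, hψg, hψH, hL]
  have hnear : ∀ᶠ q in 𝓝 (t, x), L / 2 < ψt q + F q.1 q.2 (ψ q) (ψg q) (ψH q) :=
    (hG.tendsto (t, x)).eventually_const_lt (by rw [hGL]; linarith)
  obtain ⟨δ₀, hδ₀, hball⟩ := Metric.eventually_nhds_iff.1 hnear
  obtain ⟨δ, hδ, hδδ₀, hδ1, hδT⟩ : ∃ δ : ℝ, 0 < δ ∧ δ ≤ δ₀ ∧ δ ≤ 1 ∧ δ ≤ T - t :=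
    ⟨min δ₀ (min 1 (T - t)), by simp [hδ₀, htT], min_le_left _ _,
      (min_le_right _ _).trans (min_le_left _ _), (min_le_right _ _).trans (min_le_right _ _)⟩
  have hK : IsCompact (Icc (0 : ℝ) T ×ˢ Metric.closedBall x 2) :=
    isCompact_Icc.prod (isCompact_closedBall x 2)
  obtain ⟨N₁, hN₁⟩ := hFconv _ (hK.image hJ) (L / 4) (by linarith)
  obtain ⟨N₂, hN₂⟩ := huconv _ (prod_mono_right (subset_univ _)) hK (δ ^ 4 / 4) (by positivity)
  set k := max N₁ N₂
  replace hN₁ := hN₁ k (le_max_left _ _)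
  replace hN₂ := hN₂ k (le_max_right _ _)
  -- a correction vanishing near `x` turns the maximum over the compact set into a global one
  obtain ⟨h, hh2, hh0, hhnn, hhf⟩ := exists_contDiff_radial_majorant x
    (f := fun q => φ q - uk k q - (φ (t, x) - uk k (t, x)))
    ((hφ.1.continuousOn.sub (hukcont k)).sub continuousOn_const)
  have hh1 : ContDiff ℝ 1 (deriv h) := by
    have : ContDiff ℝ (1 + 1) h := by simpa [one_add_one_eq_two] using hh2
    exact (contDiff_succ_iff_deriv.1 this).2.2
  have hC12 := hφ.sub_radial t x
    (fun r => (hd0 r).add ((hh2.differentiable (by simp)) r).hasDerivAt)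
    (fun r => (hd1 r).add ((hh1.differentiable (by simp)) r).hasDerivAt)
    (continuous_const.add (hh1.continuous_deriv le_rfl))
  have htx : (t, x) ∈ Icc (0 : ℝ) T ×ˢ Metric.closedBall x 2 := ⟨⟨ht0, htT.le⟩, by simp⟩
  obtain ⟨⟨s, y⟩, hsy, hsymax⟩ := hK.exists_isMaxOn ⟨_, htx⟩
    (hC12.1.continuousOn.sub ((hukcont k).mono (prod_mono_right (subset_univ _))))
  have hval : φ (t, x) - uk k (t, x) ≤
      φ (s, y) - ((s - t) ^ 2 + ((‖y - x‖ ^ 2) ^ 2 + h (‖y - x‖ ^ 2))) - uk k (s, y) := by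
    have h0 := isMaxOn_iff.1 hsymax (t, x) htx
    simpa [hh0 0 zero_le_one] using h0
  have hclose : (s - t) ^ 2 + (‖y - x‖ ^ 2) ^ 2 < δ ^ 4 := by
    have h1 := abs_le.1 (hN₂ _ hsy)
    have h2 := abs_le.1 (hN₂ _ htx)
    have h3 := hmax s y hsy.1.1 hsy.1.2
    have h4 := hhnn (‖y - x‖ ^ 2)
    have h5 : 0 < δ ^ 4 := by positivity
    linarith [h1.1, h2.2]
  have hy : ‖y - x‖ < δ := by
    refine lt_of_pow_lt_pow_left₀ 4 hδ.le ?_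
    nlinarith [sq_nonneg (s - t)]
  have hs : |s - t| < δ := by
    refine abs_lt_of_sq_lt_sq ?_ hδ.le
    have : δ ^ 4 ≤ δ ^ 2 := pow_le_pow_of_le_one hδ.le hδ1 (by norm_num)
    nlinarith [sq_nonneg (‖y - x‖ ^ 2)]
  have hr : ‖y - x‖ ^ 2 < 1 := by nlinarith [norm_nonneg (y - x)]
  have hsuper := huksuper k _ _ _ _ hC12 s y hsy.1.1 (by linarith [(abs_lt.1 hs).2]) (by
    intro s' y' hs0 hsT
    by_cases hy' : 2 ≤ ‖y' - x‖ ^ 2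
    · have h1 := hhf s' ⟨hs0, hsT⟩ y' hy'
      simp only [Pi.add_apply]
      nlinarith [sq_nonneg (s' - t), sq_nonneg (‖y' - x‖ ^ 2)]
    · refine hsymax (show (s', y') ∈ _ from ⟨⟨hs0, hsT⟩, ?_⟩)
      rw [mem_closedBall_iff_norm]
      nlinarith [norm_nonneg (y' - x)])
  have hdz : ∀ r < 1, deriv h r = 0 := fun r => deriv_eq_zero_of_eq_zero_on_Iic hh0
  have hddz : deriv (deriv h) (‖y - x‖ ^ 2) = 0 := by
    obtain ⟨a, ha, ha1⟩ := exists_between hr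
    exact deriv_eq_zero_of_eq_zero_on_Iic (fun r hra => hdz r (hra.trans_lt ha1)) ha
  simp only [Pi.add_apply, hh0 _ hr.le, hdz _ hr, hddz, add_zero] at hsuper
  have hF := abs_le.1 (hN₁ (J (s, y)) ⟨_, hsy, rfl⟩)
  have hL2 := hball (y := (s, y)) (by
    rw [Prod.dist_eq, dist_eq_norm, dist_eq_norm]
    exact max_lt (hs.trans_le hδδ₀) (hy.trans_le hδδ₀))
  change ψt (s, y) + Fk k s y (ψ (s, y)) (ψg (s, y)) (ψH (s, y)) ≤ 0 at hsuper
  change -(L / 4) ≤ Fk k s y (ψ (s, y)) (ψg (s, y)) (ψH (s, y)) -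
    F s y (ψ (s, y)) (ψg (s, y)) (ψH (s, y)) ∧ _ at hF
  change L / 2 < ψt (s, y) + F s y (ψ (s, y)) (ψg (s, y)) (ψH (s, y)) at hL2
  linarith [hF.1]
end

section
/- Let δ > 0, γ > 1 and ψ > 1, and define the Epstein–Zin aggregator f : [0,∞) × (−∞,0) → ℝ by f(c,u) = (δ/(1 − 1/ψ)) (1−γ) u [ c^{1−1/ψ} ((1−γ)u)^{−(1−1/ψ)/(1−γ)} − 1 ], using real powers of nonnegative reals (with 0^α = 0 for α > 0); note (1−γ)u > 0 when u < 0. Then f is monotonic in u in the sense of condition (H5): for every c ≥ 0 and all u₁, u₂ < 0, (u₁ − u₂)(f(c,u₁) − f(c,u₂)) ≤ μ (u₁ − u₂)², where μ = δ(γ−1)/(1 − 1/ψ) > 0. -/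
/-- For a nonnegative exponent `e`, the map `x ↦ x * x ^ e` is monotone on the nonnegative reals. -/
lemma sub_mul_sub_mul_rpow_nonneg {x y e : ℝ} (hx : 0 ≤ x) (hy : 0 ≤ y) (he : 0 ≤ e) :
    0 ≤ (x - y) * (x * x ^ e - y * y ^ e) := by
  rcases le_total x y with h | h
  · have : x * x ^ e ≤ y * y ^ e := by gcongr
    exact mul_nonneg_of_nonpos_of_nonpos (by linarith) (by linarith)
  · have : y * y ^ e ≤ x * x ^ e := by gcongr
    exact mul_nonneg (by linarith) (by linarith)

/-- In the case `γ > 1`, `ψ > 1`, the continuous-time Epstein–Zin aggregator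
`f(c,u) = (δ/(1 − 1/ψ))(1−γ)u [c^{1−1/ψ}((1−γ)u)^{−(1−1/ψ)/(1−γ)} − 1]` (real powers, with
`0^α = 0` for `α > 0`), defined for `c ≥ 0` and `u < 0`, satisfies the monotonicity condition
(H5) with constant `μ = δ(γ−1)/(1 − 1/ψ) > 0`. -/
theorem stmt_12 (δ γ ψ : ℝ) (hδ : 0 < δ) (hγ : 1 < γ) (hψ : 1 < ψ)
    (f : ℝ → ℝ → ℝ)
    (hf : ∀ c u : ℝ, 0 ≤ c → u < 0 →
      f c u = δ / (1 - 1 / ψ) * ((1 - γ) * u) *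
        (c ^ (1 - 1 / ψ) * ((1 - γ) * u) ^ (-(1 - 1 / ψ) / (1 - γ)) - 1)) :
    ∀ c : ℝ, 0 ≤ c → ∀ u₁ u₂ : ℝ, u₁ < 0 → u₂ < 0 →
      (u₁ - u₂) * (f c u₁ - f c u₂) ≤ δ * (γ - 1) / (1 - 1 / ψ) * (u₁ - u₂) ^ 2 := by
  intro c hc u₁ u₂ h₁ h₂
  have hρ : 0 < 1 - 1 / ψ := by
    rw [sub_pos, div_lt_one (by linarith)]
    exact hψ
  have he : 0 ≤ -(1 - 1 / ψ) / (1 - γ) :=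
    div_nonneg_of_nonpos (by linarith) (by linarith)
  have hmono := sub_mul_sub_mul_rpow_nonneg
    (mul_nonneg_of_nonpos_of_nonpos (by linarith : 1 - γ ≤ 0) h₁.le)
    (mul_nonneg_of_nonpos_of_nonpos (by linarith : 1 - γ ≤ 0) h₂.le) he
  rw [hf c u₁ hc h₁, hf c u₂ hc h₂]
  generalize ((1 - γ) * u₁) ^ (-(1 - 1 / ψ) / (1 - γ)) = p₁ at hmono ⊢
  generalize ((1 - γ) * u₂) ^ (-(1 - 1 / ψ) / (1 - γ)) = p₂ at hmono ⊢
  have hdecr : (u₁ - u₂) * ((1 - γ) * u₁ * p₁ - (1 - γ) * u₂ * p₂) ≤ 0 := by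
    refine nonpos_of_mul_nonneg_right (a := 1 - γ) ?_ (by linarith)
    linarith
  have hK : 0 ≤ δ / (1 - 1 / ψ) * c ^ (1 - 1 / ψ) := by positivity
  have hprod := mul_nonpos_of_nonneg_of_nonpos hK hdecr
  rw [mul_div_right_comm]
  linarith
end

section
/- Let δ > 0, 0 < γ < 1 and 0 < ψ < 1, and define the Epstein–Zin aggregator f : (0,∞) × (0,∞) → ℝ by f(c,u) = (δ/(1 − 1/ψ)) (1−γ) u [ c^{1−1/ψ} ((1−γ)u)^{−(1−1/ψ)/(1−γ)} − 1 ], using real powers of positive reals; note (1−γ)u > 0 when u > 0. Then f is monotonic in u in the sense of condition (H5): for every c > 0 and all u₁, u₂ > 0, (u₁ − u₂)(f(c,u₁) − f(c,u₂)) ≤ μ (u₁ − u₂)², where μ = δ(1−γ)/(1/ψ − 1) > 0. -/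
/-- For `k, p ≥ 0`, the map `u ↦ k u (k u) ^ p` is monotone on the nonnegative reals, stated as
nonnegativity of the product of increments. -/
lemma mul_sub_mul_rpow_nonneg {k p u v : ℝ} (hk : 0 ≤ k) (hp : 0 ≤ p) (hu : 0 ≤ u)
    (hv : 0 ≤ v) : 0 ≤ (u - v) * (k * u * (k * u) ^ p - k * v * (k * v) ^ p) := by
  have mono : ∀ x y : ℝ, 0 ≤ x → x ≤ y → k * x * (k * x) ^ p ≤ k * y * (k * y) ^ p := by
    intro x y hx hxy
    have hy : 0 ≤ y := hx.trans hxy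
    gcongr
  rcases le_total u v with h | h
  · exact mul_nonneg_of_nonpos_of_nonpos (sub_nonpos.2 h) (sub_nonpos.2 (mono u v hu h))
  · exact mul_nonneg (sub_nonneg.2 h) (sub_nonneg.2 (mono v u hv h))

/-- In the case `0 < γ < 1`, `0 < ψ < 1`, the continuous-time Epstein–Zin
aggregator `f(c,u) = (δ/(1 − 1/ψ))(1−γ)u [c^{1−1/ψ}((1−γ)u)^{−(1−1/ψ)/(1−γ)} − 1]` (real
powers), defined for `c > 0` and `u > 0`, satisfies the monotonicity condition (H5) with
constant `μ = δ(1−γ)/(1/ψ − 1) > 0`. -/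
theorem stmt_13 (δ γ ψ : ℝ) (hδ : 0 < δ) (hγ0 : 0 < γ) (hγ1 : γ < 1)
    (hψ0 : 0 < ψ) (hψ1 : ψ < 1)
    (f : ℝ → ℝ → ℝ)
    (hf : ∀ c u : ℝ, 0 < c → 0 < u →
      f c u = δ / (1 - 1 / ψ) * ((1 - γ) * u) *
        (c ^ (1 - 1 / ψ) * ((1 - γ) * u) ^ (-(1 - 1 / ψ) / (1 - γ)) - 1)) :
    ∀ c : ℝ, 0 < c → ∀ u₁ u₂ : ℝ, 0 < u₁ → 0 < u₂ →
      (u₁ - u₂) * (f c u₁ - f c u₂) ≤ δ * (1 - γ) / (1 / ψ - 1) * (u₁ - u₂) ^ 2 := by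
  intro c hc u₁ u₂ h₁ h₂
  have ha : 0 < 1 / ψ - 1 := sub_pos.2 ((one_lt_div hψ0).2 hψ1)
  have hk : 0 < 1 - γ := sub_pos.2 hγ1
  have hp : 0 ≤ -(1 - 1 / ψ) / (1 - γ) := div_nonneg (by linarith) hk.le
  have hC : 0 ≤ δ / (1 / ψ - 1) * c ^ (1 - 1 / ψ) := by positivity
  have key := mul_nonneg hC (mul_sub_mul_rpow_nonneg hk.le hp h₁.le h₂.le)
  have hneg : δ / (1 - 1 / ψ) = -(δ / (1 / ψ - 1)) := by
    rw [← div_neg, neg_sub]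
  rw [hf c u₁ hc h₁, hf c u₂ hc h₂, hneg, mul_div_right_comm]
  linear_combination key
end
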